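/- Let D ⊆ ℂ be a domain, let A be a closed polar subset of D, and let f be holomorphic on D \ A. Then the set Γ_f ∪ (A × ℂ) is complete pluripolar in D × ℂ. -/

import Mathlib

open Set Metric MeasureTheory Filter Topology

noncomputable section

open Classical in
/-- The average of an `EReal`-valued function over the circle of center `z` and radius `r`;
it is `⊥` if the function equals `⊥` on a set of positive measure of the circle or if
its (finite) values are not integrable over the circle. -/
def circleAvg (u : ℂ → EReal) (z : ℂ) (r : ℝ) : EReal :=
  if (IntervalIntegrable (fun θ : ℝ => (u (circleMap z r θ)).toReal) volume 0 (2 * Real.pi)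
      ∧ ∀ᵐ θ ∂(volume.restrict (Set.Ioc (0:ℝ) (2 * Real.pi))), u (circleMap z r θ) ≠ ⊥)
  then (((∫ θ in (0:ℝ)..(2 * Real.pi), (u (circleMap z r θ)).toReal) / (2 * Real.pi) : ℝ) : EReal)
  else ⊥

/-- `u` is plurisubharmonic on a (typically open) set `Ω` of a complex vector space:
it takes values in `[-∞, ∞)`, is upper semicontinuous on `Ω`, is not identically `-∞`
on any connected component of `Ω`, and its restriction to every complex line satisfies
the sub-mean value inequality on circles (whose closed discs lie in `Ω`). -/
def PSHOn {E : Type*} [NormedAddCommGroup E] [NormedSpace ℂ E]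
    (u : E → EReal) (Ω : Set E) : Prop :=
  (∀ z ∈ Ω, u z ≠ ⊤) ∧
  UpperSemicontinuousOn u Ω ∧
  (∀ z ∈ Ω, ∃ w ∈ connectedComponentIn Ω z, u w ≠ ⊥) ∧
  ∀ a b : E, ∀ c : ℂ, ∀ r : ℝ, 0 < r →
    (∀ l ∈ Metric.closedBall c r, a + l • b ∈ Ω) →
    u (a + c • b) ≤ circleAvg (fun l : ℂ => u (a + l • b)) c r

/-- In one complex variable, plurisubharmonic = subharmonic. -/
abbrev SubharmonicOn (u : ℂ → EReal) (Ω : Set ℂ) : Prop := PSHOn u Ω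

/-- A set `P ⊆ ℂ` is polar if `P ⊆ {u = -∞}` for some subharmonic `u` on `ℂ`
(not identically `-∞`). -/
def PolarSet (P : Set ℂ) : Prop :=
  ∃ u : ℂ → EReal, SubharmonicOn u Set.univ ∧ ∀ z ∈ P, u z = ⊥

/-- `S` is pluripolar in `Ω`. -/
def PluripolarIn {E : Type*} [NormedAddCommGroup E] [NormedSpace ℂ E]
    (S Ω : Set E) : Prop :=
  ∃ u : E → EReal, PSHOn u Ω ∧ ∀ z ∈ S, u z = ⊥

/-- `S` is complete pluripolar in `Ω`: `S` is exactly the `-∞`-set of some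
plurisubharmonic function on `Ω`. -/
def CompletePluripolarIn {E : Type*} [NormedAddCommGroup E] [NormedSpace ℂ E]
    (S Ω : Set E) : Prop :=
  ∃ u : E → EReal, PSHOn u Ω ∧ ∀ z ∈ Ω, (u z = ⊥ ↔ z ∈ S)

/-- The pluripolar hull `S*_Ω` of `S` in `Ω`. -/
def pluripolarHull {E : Type*} [NormedAddCommGroup E] [NormedSpace ℂ E]
    (S Ω : Set E) : Set E :=
  {z ∈ Ω | ∀ u : E → EReal, PSHOn u Ω → (∀ w ∈ S, u w = ⊥) → u z = ⊥}

/-- `S` is (pluri-)thin at `ζ`: either `ζ` is not a limit point of `S \ {ζ}`, or there is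
a plurisubharmonic function on a neighborhood of `ζ` with
`limsup_{z → ζ, z ∈ S \ {ζ}} u z < u ζ`. -/
def PluriThinAt {E : Type*} [NormedAddCommGroup E] [NormedSpace ℂ E]
    (S : Set E) (ζ : E) : Prop :=
  ζ ∉ closure (S \ {ζ}) ∨
  ∃ U : Set E, IsOpen U ∧ ζ ∈ U ∧ ∃ u : E → EReal, PSHOn u U ∧
    Filter.limsup u (nhdsWithin ζ (S \ {ζ})) < u ζ

/-- Thinness in `ℂ`. -/
abbrev ThinAt (S : Set ℂ) (ζ : ℂ) : Prop := PluriThinAt S ζ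

/-- The relative extremal function (pluriharmonic measure) `ω(z, A, D)`:
`-sup { u(z) : u` psh on `D`, `u ≤ 0` on `D`, `u ≤ -1` on `A }`, where for points of `A`
not belonging to `D` the condition `u ≤ -1` is understood as
`limsup_{ζ → w, ζ ∈ D} u(ζ) ≤ -1` (for `w ∈ A ∩ D` and `u` upper semicontinuous the
condition below is equivalent to `u w ≤ -1`). -/
def relExtremal {E : Type*} [NormedAddCommGroup E] [NormedSpace ℂ E]
    (z : E) (A D : Set E) : EReal :=
  - sSup {y : EReal | ∃ u : E → EReal, PSHOn u D ∧ (∀ w ∈ D, u w ≤ 0) ∧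
      (∀ w ∈ A, Filter.limsup u (nhdsWithin w (insert w D)) ≤ -1) ∧ y = u z}

/-- `ζ` is a regular boundary point of `Ω` if `ζ ∈ ∂Ω` and `ℂ \ Ω` is non-thin at `ζ`. -/
def RegularBoundaryPoint (Ω : Set ℂ) (ζ : ℂ) : Prop :=
  ζ ∈ frontier Ω ∧ ¬ ThinAt Ωᶜ ζ

/-- The graph `Γ_f = {(z, f z) : z ∈ S} ⊆ ℂ²` of `f` over `S`. -/
def graphOver (f : ℂ → ℂ) (S : Set ℂ) : Set (ℂ × ℂ) := {p | p.1 ∈ S ∧ p.2 = f p.1}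

/-- `e^x` for `x ∈ [-∞, ∞)`, as a map to `[0, ∞)`. -/
def expEReal (x : EReal) : ℝ := if x = ⊥ then 0 else Real.exp x.toReal

end



/-- `φ` has a harmonic local support from below at `l`. -/
def SuppAt (φ : ℂ → ℝ) (l : ℂ) : Prop :=
  ∃ h : ℂ → ℂ, AnalyticAt ℂ h l ∧ (h l).re = φ l ∧ ∀ᶠ x in 𝓝 l, (h x).re ≤ φ x

lemma SuppAt.congr {φ ψ : ℂ → ℝ} {l : ℂ} (h : SuppAt φ l) (e : φ =ᶠ[𝓝 l] ψ) : SuppAt ψ l := by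
  obtain ⟨H, h1, h2, h3⟩ := h
  refine ⟨H, h1, h2.trans e.self_of_nhds, ?_⟩
  filter_upwards [h3, e] with x a b
  rw [← b]; exact a

lemma SuppAt.of_le {φ ψ : ℂ → ℝ} {l : ℂ} (h : SuppAt φ l) (e : ∀ᶠ x in 𝓝 l, φ x ≤ ψ x)
    (e' : φ l = ψ l) : SuppAt ψ l := by
  obtain ⟨H, h1, h2, h3⟩ := h
  refine ⟨H, h1, h2.trans e', ?_⟩
  filter_upwards [h3, e] with x a b
  exact a.trans b

lemma SuppAt.const (c : ℝ) (l : ℂ) : SuppAt (fun _ => c) l :=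
  ⟨fun _ => (c : ℂ), analyticAt_const, by simp, by simp⟩

lemma SuppAt.add {φ ψ : ℂ → ℝ} {l : ℂ} (h : SuppAt φ l) (h' : SuppAt ψ l) :
    SuppAt (fun x => φ x + ψ x) l := by
  obtain ⟨H, h1, h2, h3⟩ := h
  obtain ⟨H', h1', h2', h3'⟩ := h'
  refine ⟨fun x => H x + H' x, h1.add h1', by simp [h2, h2'], ?_⟩
  filter_upwards [h3, h3'] with x a b
  simp only [Complex.add_re]; linarith

lemma SuppAt.smul {φ : ℂ → ℝ} {l : ℂ} (h : SuppAt φ l) {c : ℝ} (hc : 0 ≤ c) :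
    SuppAt (fun x => c * φ x) l := by
  obtain ⟨H, h1, h2, h3⟩ := h
  refine ⟨fun x => (c : ℂ) * H x, analyticAt_const.mul h1, by simp [h2], ?_⟩
  filter_upwards [h3] with x a
  simp only [Complex.re_ofReal_mul]
  exact mul_le_mul_of_nonneg_left a hc

lemma SuppAt.max {φ ψ : ℂ → ℝ} {l : ℂ} (h : SuppAt φ l) (h' : SuppAt ψ l) :
    SuppAt (fun x => max (φ x) (ψ x)) l := by
  rcases le_total (φ l) (ψ l) with e | e
  · exact h'.of_le (Eventually.of_forall fun x => le_max_right _ _) (by simp [e])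
  · exact h.of_le (Eventually.of_forall fun x => le_max_left _ _) (by simp [e])

lemma SuppAt.log_norm {g : ℂ → ℂ} {l : ℂ} (hg : AnalyticAt ℂ g l) (h0 : g l ≠ 0) :
    SuppAt (fun x => Real.log ‖g x‖) l := by
  have h1 : AnalyticAt ℂ (fun x => g x / g l) l := hg.div analyticAt_const h0
  have h2 : AnalyticAt ℂ (fun x => Complex.log (g x / g l)) l := by
    apply h1.clog
    simp [div_self h0, Complex.mem_slitPlane_iff]
  refine ⟨fun x => Complex.log (g x / g l) + (Real.log ‖g l‖ : ℝ), h2.add analyticAt_const, ?_, ?_⟩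
  · simp [div_self h0]
  · filter_upwards [hg.continuousAt.eventually_ne h0] with x hx
    simp only [Complex.add_re, Complex.log_re, Complex.ofReal_re, norm_div]
    rw [Real.log_div (by simpa using hx) (by simpa using h0)]
    simp

lemma SuppAt.neg_log_norm {g : ℂ → ℂ} {l : ℂ} (hg : AnalyticAt ℂ g l) (h0 : g l ≠ 0) :
    SuppAt (fun x => - Real.log ‖g x‖) l := by
  have := SuppAt.log_norm (hg.inv h0) (inv_ne_zero h0)
  simpa using this

lemma SuppAt.log_max {g : ℂ → ℂ} {l : ℂ} (hg : AnalyticAt ℂ g l) {δ : ℝ} (hδ : 0 < δ) :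
    SuppAt (fun x => Real.log (Max.max ‖g x‖ δ)) l := by
  rcases le_or_gt (‖g l‖) δ with e | e
  · exact (SuppAt.const (Real.log δ) l).of_le (Eventually.of_forall fun x =>
      Real.log_le_log hδ (le_max_right _ _)) (by simp [e])
  · have h0 : g l ≠ 0 := by
      intro h; simp [h] at e; linarith
    refine (SuppAt.log_norm hg h0).of_le ?_ (by simp [e.le])
    filter_upwards [hg.continuousAt.eventually_ne h0] with x hx
    exact Real.log_le_log (by simpa using hx) (le_max_left _ _)

/-- maximum principle -/
lemma SuppAt.max_principle {ψ : ℂ → ℝ} {c : ℂ} {R M : ℝ} (hR : 0 < R)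
    (hc : ContinuousOn ψ (closedBall c R)) (hs : ∀ l ∈ ball c R, SuppAt ψ l)
    (hM : ∀ l ∈ sphere c R, ψ l ≤ M) : ψ c ≤ M := by
  by_contra! hcon
  have hK : IsCompact (closedBall c R) := isCompact_closedBall c R
  obtain ⟨l0, hl0, hmax⟩ := hK.exists_isMaxOn ⟨c, mem_closedBall_self hR.le⟩ hc
  have hSc : IsCompact (closedBall c R ∩ ψ ⁻¹' {ψ l0}) :=
    hK.of_isClosed_subset (hc.preimage_isClosed_of_isClosed isClosed_closedBall isClosed_singleton)
      inter_subset_left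
  obtain ⟨l1, ⟨hl1, hl1'⟩, hfar⟩ := hSc.exists_isMaxOn ⟨l0, hl0, rfl⟩
    (f := fun l => dist l c) (by fun_prop)
  simp only [mem_preimage, mem_singleton_iff] at hl1'
  have hgt : M < ψ l1 := by
    rw [hl1']; exact hcon.trans_le (hmax (mem_closedBall_self hR.le))
  have hb : l1 ∈ ball c R := by
    rcases lt_or_eq_of_le (mem_closedBall.1 hl1) with h | h
    · exact h
    · exact absurd (hM l1 h) (not_le.2 hgt)
  obtain ⟨H, h1, h2, h3⟩ := hs l1 hb
  have hnb : ∀ᶠ x in 𝓝 l1, x ∈ ball c R := isOpen_ball.mem_nhds hb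
  have hloc : IsLocalMax (norm ∘ fun x => Complex.exp (H x)) l1 := by
    filter_upwards [h3, hnb] with x hx hxb
    simp only [Function.comp, Complex.norm_exp]
    apply Real.exp_le_exp.2
    rw [h2, hl1']
    exact hx.trans (hmax (ball_subset_closedBall hxb))
  have hd : ∀ᶠ z in 𝓝 l1, DifferentiableAt ℂ (fun x => Complex.exp (H x)) z := by
    filter_upwards [h1.eventually_analyticAt] with z hz
    exact hz.differentiableAt.cexp
  have hconst := Complex.eventually_eq_of_isLocalMax_norm hd hloc
  have hev : ∀ᶠ x in 𝓝 l1, x ∈ closedBall c R ∩ ψ ⁻¹' {ψ l0} := by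
    filter_upwards [h3, hnb, hconst] with x hx hxb he
    refine ⟨ball_subset_closedBall hxb, ?_⟩
    have e1 : (H x).re = (H l1).re := by
      have := congrArg norm he
      simpa [Complex.norm_exp] using this
    have : ψ x ≤ ψ l0 := hmax (ball_subset_closedBall hxb)
    simp only [mem_preimage, mem_singleton_iff]
    linarith
  -- move outward
  have hdir : ∃ d : ℂ, ∀ t : ℝ, 0 < t → dist l1 c < dist (l1 + t * d) c := by
    by_cases h : l1 = c
    · refine ⟨1, fun t ht => ?_⟩
      simp [h, ht.ne']
    · refine ⟨l1 - c, fun t ht => ?_⟩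
      have : l1 + t * (l1 - c) - c = (1 + t : ℝ) * (l1 - c) := by push_cast; ring
      rw [dist_eq_norm, dist_eq_norm, this, norm_mul, Complex.norm_real, Real.norm_eq_abs,
        abs_of_pos (by linarith)]
      have : 0 < ‖l1 - c‖ := by simpa [sub_eq_zero] using h
      nlinarith
  obtain ⟨d, hd'⟩ := hdir
  have ht : Tendsto (fun t : ℝ => l1 + t * d) (𝓝[>] 0) (𝓝 l1) := by
    have : Continuous (fun t : ℝ => l1 + t * d) := by fun_prop
    have := this.tendsto 0
    simp only [Complex.ofReal_zero, zero_mul, add_zero] at this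
    exact this.mono_left nhdsWithin_le_nhds
  obtain ⟨t, ht1, ht2⟩ := ((ht.eventually hev).and self_mem_nhdsWithin).exists
  have := hfar ht1
  simp only [mem_ofPred_eq] at this
  exact absurd (hd' t ht2) (not_lt.2 this)

/-- a continuous function on the circle is approximated by real parts of entire functions -/
lemma exists_entire_approx (g : ℝ → ℝ) (hg : Continuous g) (hper : Function.Periodic g (2 * Real.pi))
    {ε : ℝ} (hε : 0 < ε) :
    ∃ P : ℂ → ℂ, Differentiable ℂ P ∧ ∀ θ : ℝ, |(P (Complex.exp (θ * Complex.I))).re - g θ| ≤ ε := by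
  have : Fact (0 < 2 * Real.pi) := ⟨Real.two_pi_pos⟩
  let G : C(AddCircle (2 * Real.pi), ℂ) :=
    ⟨fun x => ((hper.lift x : ℝ) : ℂ), by
      apply Complex.continuous_ofReal.comp
      exact continuous_coinduced_dom.2 hg⟩
  have hcl : G ∈ (Submodule.span ℂ (range <| @fourier (2 * Real.pi))).topologicalClosure := by
    rw [span_fourier_closure_eq_top]; trivial
  have hcl' : G ∈ closure ((Submodule.span ℂ (range <| @fourier (2 * Real.pi)) : Submodule ℂ _) : Set C(AddCircle (2 * Real.pi), ℂ)) := hcl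
  obtain ⟨F, hF, hFG⟩ := Metric.mem_closure_iff.1 hcl' ε hε
  have key : ∀ F ∈ Submodule.span ℂ (range <| @fourier (2 * Real.pi)), ∀ a : ℂ,
      ∃ P : ℂ → ℂ, Differentiable ℂ P ∧
      ∀ θ : ℝ, (P (Complex.exp (θ * Complex.I))).re = (a * F (θ : AddCircle (2 * Real.pi))).re := by
    intro F hF
    induction hF using Submodule.span_induction with
    | mem x h =>
      obtain ⟨n, rfl⟩ := h
      intro a
      have hfour : ∀ θ : ℝ, fourier n (θ : AddCircle (2 * Real.pi)) = Complex.exp (n * (θ * Complex.I)) := by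
        intro θ
        rw [fourier_coe_apply]
        congr 1
        have : (Real.pi : ℂ) ≠ 0 := by exact_mod_cast Real.pi_ne_zero
        push_cast
        field_simp
      rcases Int.eq_nat_or_neg n with ⟨m, rfl | rfl⟩
      · refine ⟨fun z => a * z ^ m, by fun_prop, fun θ => ?_⟩
        simp only [hfour, ← Complex.exp_nat_mul]; simp
      · refine ⟨fun z => (starRingEnd ℂ a) * z ^ m, by fun_prop, fun θ => ?_⟩
        simp only [hfour, ← Complex.exp_nat_mul]
        rw [← Complex.conj_re]
        congr 1
        simp [← Complex.exp_conj]
    | zero => intro a; exact ⟨fun _ => 0, by fun_prop, by simp⟩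
    | add x y _ _ hx hy =>
      intro a
      obtain ⟨P, hP, hP'⟩ := hx a
      obtain ⟨Q, hQ, hQ'⟩ := hy a
      refine ⟨fun z => P z + Q z, by fun_prop, fun θ => ?_⟩
      simp only [Complex.add_re, hP', hQ', ContinuousMap.add_apply, mul_add]
    | smul b x _ hx =>
      intro a
      obtain ⟨P, hP, hP'⟩ := hx (a * b)
      refine ⟨P, hP, fun θ => ?_⟩
      rw [hP']
      simp [mul_assoc]
  obtain ⟨P, hP, hP'⟩ := key F hF 1
  refine ⟨P, hP, fun θ => ?_⟩
  have h1 : dist (G θ) (F θ) ≤ ε := (ContinuousMap.dist_apply_le_dist _).trans hFG.le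
  rw [hP', one_mul]
  have h2 : (F θ).re - g θ = (F θ - G θ).re := by
    simp [G]
  rw [h2]
  refine (Complex.abs_re_le_norm _).trans ?_
  rwa [dist_comm, dist_eq_norm] at h1

lemma SuppAt.le_circleAverage {φ : ℂ → ℝ} {c : ℂ} {R : ℝ} (hR : 0 < R)
    (hc : ContinuousOn φ (closedBall c R)) (hs : ∀ l ∈ ball c R, SuppAt φ l) :
    φ c ≤ Real.circleAverage φ c R := by
  apply le_of_forall_pos_le_add
  intro e he
  have hsph : ContinuousOn φ (sphere c R) := hc.mono sphere_subset_closedBall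
  have hcm : Continuous (fun θ => φ (circleMap c R θ)) :=
    hsph.comp_continuous (continuous_circleMap c R) (fun θ => circleMap_mem_sphere c hR.le θ)
  obtain ⟨P, hP, hP'⟩ := exists_entire_approx (fun θ => φ (circleMap c R θ)) hcm
    (fun θ => by simp only [periodic_circleMap c R θ]) (half_pos he)
  let Q : ℂ → ℂ := fun z => P ((z - c) / R)
  have hQ : Differentiable ℂ Q := by
    apply hP.comp; fun_prop
  have hRc : (R : ℂ) ≠ 0 := by exact_mod_cast hR.ne'
  have hQc : ∀ θ, Q (circleMap c R θ) = P (Complex.exp (θ * Complex.I)) := by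
    intro θ
    simp only [Q, circleMap, add_sub_cancel_left]
    rw [mul_div_cancel_left₀ _ hRc]
  have hQm : Real.circleAverage (fun z => (Q z).re) c R = (Q c).re := by
    apply InnerProductSpace.HarmonicOnNhd.circleAverage_eq
    intro z _
    exact (hQ.analyticAt z).harmonicAt_re
  have hmax : φ c + -(Q c).re ≤ e / 2 := by
    apply SuppAt.max_principle (ψ := fun z => φ z + -(Q z).re) hR
    · apply hc.add
      exact (Complex.continuous_re.comp hQ.continuous).neg.continuousOn
    · intro l hl
      refine (hs l hl).add ⟨fun z => - Q z, (hQ.analyticAt l).neg, by simp, by simp⟩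
    · intro l hl
      rw [← abs_of_pos hR, ← image_circleMap_Ioc c R] at hl
      obtain ⟨θ, -, rfl⟩ := hl
      have := hP' θ
      rw [← hQc] at this
      rw [abs_le] at this
      linarith [this.1]
  have hQcont : Continuous (fun z => (Q z).re) := Complex.continuous_re.comp hQ.continuous
  have hle : Real.circleAverage (fun z => (Q z).re) c R ≤ Real.circleAverage (fun z => φ z + e/2) c R := by
    apply Real.circleAverage_mono
    · exact hQcont.continuousOn.circleIntegrable hR.le
    · exact (hsph.add continuousOn_const).circleIntegrable hR.le
    · intro l hl
      rw [← image_circleMap_Ioc c R] at hl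
      obtain ⟨θ, -, rfl⟩ := hl
      have := hP' θ
      rw [← hQc] at this
      rw [abs_le] at this
      linarith [this.2]
  have hadd : Real.circleAverage (fun z => φ z + e/2) c R = Real.circleAverage φ c R + e/2 := by
    have := Real.circleAverage_add (f₁ := φ) (f₂ := fun _ => e/2) (c := c) (R := R)
      (hsph.circleIntegrable hR.le) (continuousOn_const.circleIntegrable hR.le)
    rw [Real.circleAverage_const] at this
    exact this
  linarith


lemma SuppAt.shift {ψ : ℂ → ℝ} (h : SuppAt ψ 0) (l : ℂ) : SuppAt (fun x => ψ (x - l)) l := by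
  obtain ⟨H, h1, h2, h3⟩ := h
  have ht : Tendsto (fun x : ℂ => x - l) (𝓝 l) (𝓝 0) := by
    have : Continuous (fun x : ℂ => x - l) := by fun_prop
    simpa using this.tendsto l
  refine ⟨fun x => H (x - l), ?_, by simpa using h2, ht.eventually h3⟩
  have h1' : AnalyticAt ℂ H ((fun x : ℂ => x - l) l) := by simpa using h1
  exact h1'.comp (f := fun x : ℂ => x - l) (by fun_prop)

/-- Continuous with harmonic support along every complex line. -/
def Good (T : ℂ × ℂ → ℝ) (p : ℂ × ℂ) : Prop :=
  ContinuousAt T p ∧ ∀ b : ℂ × ℂ, SuppAt (fun l : ℂ => T (p + l • b)) 0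

lemma tendsto_line (p b : ℂ × ℂ) : Tendsto (fun l : ℂ => p + l • b) (𝓝 0) (𝓝 p) := by
  have : Continuous (fun l : ℂ => p + l • b) := by fun_prop
  simpa using this.tendsto 0

lemma analyticAt_line {G : ℂ × ℂ → ℂ} {p : ℂ × ℂ} (hG : AnalyticAt ℂ G p) (b : ℂ × ℂ) :
    AnalyticAt ℂ (fun l : ℂ => G (p + l • b)) 0 := by
  have h1' : AnalyticAt ℂ G ((fun l : ℂ => p + l • b) 0) := by simpa using hG
  exact h1'.comp (f := fun l : ℂ => p + l • b) (by fun_prop)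

lemma Good.congr {T S : ℂ × ℂ → ℝ} {p} (h : Good T p) (e : T =ᶠ[𝓝 p] S) : Good S p :=
  ⟨h.1.congr e, fun b => (h.2 b).congr ((tendsto_line p b).eventually e)⟩

lemma Good.const (c : ℝ) (p) : Good (fun _ => c) p := ⟨continuousAt_const, fun _ => SuppAt.const c 0⟩

lemma Good.add {T S : ℂ × ℂ → ℝ} {p} (h : Good T p) (h' : Good S p) :
    Good (fun x => T x + S x) p := ⟨h.1.add h'.1, fun b => (h.2 b).add (h'.2 b)⟩

lemma Good.smul {T : ℂ × ℂ → ℝ} {p} (h : Good T p) {c : ℝ} (hc : 0 ≤ c) :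
    Good (fun x => c * T x) p := ⟨h.1.const_mul c, fun b => (h.2 b).smul hc⟩

lemma Good.max {T S : ℂ × ℂ → ℝ} {p} (h : Good T p) (h' : Good S p) :
    Good (fun x => max (T x) (S x)) p := ⟨h.1.max h'.1, fun b => (h.2 b).max (h'.2 b)⟩

lemma Good.log_max {G : ℂ × ℂ → ℂ} {p} (hG : AnalyticAt ℂ G p) {δ : ℝ} (hδ : 0 < δ) :
    Good (fun x => Real.log (Max.max ‖G x‖ δ)) p := by
  refine ⟨?_, fun b => SuppAt.log_max (analyticAt_line hG b) hδ⟩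
  have : 0 < Max.max ‖G p‖ δ := lt_max_of_lt_right hδ
  exact (hG.continuousAt.norm.max continuousAt_const).log this.ne'

lemma Good.le_circleAverage {T : ℂ × ℂ → ℝ} {a b : ℂ × ℂ} {c : ℂ} {R : ℝ} (hR : 0 < R)
    (h : ∀ l ∈ closedBall c R, Good T (a + l • b)) :
    T (a + c • b) ≤ Real.circleAverage (fun l => T (a + l • b)) c R := by
  apply SuppAt.le_circleAverage (φ := fun l => T (a + l • b)) hR
  · intro l hl
    apply ContinuousAt.continuousWithinAt
    exact ContinuousAt.comp (f := fun l : ℂ => a + l • b) (h l hl).1 (by fun_prop)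
  · intro l hl
    have := ((h l (ball_subset_closedBall hl)).2 b).shift l
    refine this.congr (Eventually.of_forall fun x => ?_)
    simp only
    congr 1
    rw [sub_smul]; abel

section Sum

variable {T : ℕ → ℂ × ℂ → ℝ}

open Classical in
/-- The sum of the series, `⊥` if divergent. -/
noncomputable def sumFn (T : ℕ → ℂ × ℂ → ℝ) (p : ℂ × ℂ) : EReal :=
  if Summable (fun k => T k p) then ((∑' k, T k p : ℝ) : EReal) else ⊥

lemma sumFn_toReal (T : ℕ → ℂ × ℂ → ℝ) (p : ℂ × ℂ) : (sumFn T p).toReal = ∑' k, T k p := by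
  unfold sumFn
  split_ifs with h
  · simp
  · simp [tsum_eq_zero_of_not_summable h]

lemma sumFn_ne_bot {p : ℂ × ℂ} : sumFn T p ≠ ⊥ ↔ Summable (fun k => T k p) := by
  unfold sumFn
  split_ifs with h <;> simp [h]

lemma sumFn_le {p : ℂ × ℂ} {n : ℕ} (h : ∀ k ≥ n, T k p ≤ 0) :
    sumFn T p ≤ ((∑ k ∈ Finset.range n, T k p : ℝ) : EReal) := by
  unfold sumFn
  split_ifs with hs
  · rw [EReal.coe_le_coe_iff, ← hs.sum_add_tsum_nat_add n]
    have : ∑' k, T (k + n) p ≤ 0 := tsum_nonpos fun k => h _ (by omega)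
    linarith
  · simp

lemma exists_sum_lt {p : ℂ × ℂ} {n : ℕ} (h : ∀ k ≥ n, T k p ≤ 0) {y : EReal} (hy : sumFn T p < y) :
    ∃ m ≥ n, ((∑ k ∈ Finset.range m, T k p : ℝ) : EReal) < y := by
  by_cases hs : Summable (fun k => T k p)
  · have ht := hs.hasSum.tendsto_sum_nat
    have ht' : Tendsto (fun m => ((∑ k ∈ Finset.range m, T k p : ℝ) : EReal)) atTop
        (𝓝 (((∑' k, T k p : ℝ)) : EReal)) := (continuous_coe_real_ereal.tendsto _).comp ht
    have hy' : ((∑' k, T k p : ℝ) : EReal) < y := by simpa [sumFn, hs] using hy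
    obtain ⟨m, h1, h2⟩ := ((ht'.eventually_lt_const hy').and (eventually_ge_atTop n)).exists
    exact ⟨m, h2, h1⟩
  · by_contra! hcon
    apply hs
    have hy' : ⊥ < y := by simpa [sumFn, hs] using hy
    obtain ⟨x, hx1, hx2⟩ := EReal.lt_iff_exists_real_btwn.1 hy'
    rw [← summable_nat_add_iff n, ← summable_neg_iff]
    apply summable_of_sum_range_le (c := (∑ k ∈ Finset.range n, T k p) - x)
    · intro k; simpa using h (k + n) (by omega)
    · intro m
      have h1 := hcon (n + m) (by omega)
      have h2 : x < ∑ k ∈ Finset.range (n + m), T k p := by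
        exact_mod_cast hx2.trans_le h1
      rw [Finset.sum_range_add] at h2
      simp only [Pi.neg_apply, Finset.sum_neg_distrib]
      have : ∑ i ∈ Finset.range m, T (i + n) p = ∑ i ∈ Finset.range m, T (n + i) p := by
        simp only [add_comm]
      linarith

lemma sumFn_submean {Ω : Set (ℂ × ℂ)} (hgood : ∀ k, ∀ p ∈ Ω, Good (T k) p)
    (hneg : ∀ K ⊆ Ω, IsCompact K → ∀ᶠ k in atTop, ∀ p ∈ K, T k p ≤ 0)
    (a b : ℂ × ℂ) (c : ℂ) (r : ℝ) (hr : 0 < r) (hΩ : ∀ l ∈ closedBall c r, a + l • b ∈ Ω) :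
    sumFn T (a + c • b) ≤ circleAvg (fun l : ℂ => sumFn T (a + l • b)) c r := by
  by_cases hs : Summable (fun k => T k (a + c • b))
  swap
  · simp [sumFn, hs]
  set K := (fun l : ℂ => a + l • b) '' closedBall c r with hK
  have hKc : IsCompact K := (isCompact_closedBall c r).image (by fun_prop)
  obtain ⟨n, hn⟩ := eventually_atTop.1 (hneg K (by rintro _ ⟨l, hl, rfl⟩; exact hΩ l hl) hKc)
  set F : ℕ → ℝ → ℝ := fun k θ => T k (a + circleMap c r θ • b) with hF
  have hcirc : ∀ θ, circleMap c r θ ∈ closedBall c r := fun θ => circleMap_mem_closedBall c hr.le θ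
  have hFc : ∀ k, Continuous (F k) := by
    intro k
    rw [continuous_iff_continuousAt]
    intro θ
    exact ContinuousAt.comp (f := fun θ : ℝ => a + circleMap c r θ • b)
      (hgood k _ (hΩ _ (hcirc θ))).1 (by have := continuous_circleMap c r; fun_prop)
  set μ := volume.restrict (Ioc (0:ℝ) (2 * Real.pi)) with hμ
  have hpi := Real.two_pi_pos
  have hFi : ∀ k, Integrable (F k) μ := fun k =>
    ((hFc k).intervalIntegrable 0 (2 * Real.pi)).1
  have hmean : ∀ k, T k (a + c • b) ≤ (∫ θ, F k θ ∂μ) / (2 * Real.pi) := by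
    intro k
    have := Good.le_circleAverage (T := T k) hr (fun l hl => hgood k _ (hΩ l hl))
    rw [Real.circleAverage, intervalIntegral.integral_of_le hpi.le, smul_eq_mul,
      inv_mul_eq_div] at this
    exact this
  have hnF : ∀ k ≥ n, ∀ θ, F k θ ≤ 0 := fun k hk θ => hn k hk _ ⟨_, hcirc θ, rfl⟩
  have hFs : Summable fun k => ∫ θ, ‖F k θ‖ ∂μ := by
    rw [← summable_nat_add_iff n]
    have hs' : Summable fun k => (2 * Real.pi) * (- T (k + n) (a + c • b)) :=
      (((summable_nat_add_iff n).2 hs).neg).mul_left _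
    refine hs'.of_nonneg_of_le (fun k => integral_nonneg fun θ => norm_nonneg _) (fun k => ?_)
    have : ∫ θ, ‖F (k + n) θ‖ ∂μ = - ∫ θ, F (k + n) θ ∂μ := by
      rw [← integral_neg]
      congr 1; ext θ
      rw [Real.norm_eq_abs, abs_of_nonpos (hnF _ (by omega) θ)]
    rw [this]
    have := hmean (k + n)
    rw [le_div_iff₀ hpi] at this
    linarith
  have hsum := hasSum_integral_of_summable_integral_norm hFi hFs
  -- a.e. summability and integrability
  have hlint : ∫⁻ θ, ∑' k, ‖F k θ‖ₑ ∂μ ≠ ⊤ := by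
    rw [lintegral_tsum (fun k => (hFc k).measurable.enorm.aemeasurable)]
    have (i : ℕ) : ∫⁻ θ, ‖F i θ‖ₑ ∂μ = ENNReal.ofReal (∫ θ, ‖F i θ‖ ∂μ) := by
      rw [ofReal_integral_norm_eq_lintegral_enorm (hFi i)]
    simp_rw [this]
    exact hFs.tsum_ofReal_ne_top
  have hae : ∀ᵐ θ ∂μ, Summable (fun k => F k θ) := by
    have h1 := ae_lt_top' (f := fun θ => ∑' k, ‖F k θ‖ₑ)
      (AEMeasurable.ennreal_tsum fun k => (hFc k).measurable.enorm.aemeasurable) hlint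
    filter_upwards [h1] with θ hθ
    apply Summable.of_norm
    rw [← summable_norm_iff] 
    have := ENNReal.summable_toReal hθ.ne
    simpa using this
  have hintegr : Integrable (fun θ => ∑' k, F k θ) μ := by
    refine ⟨?_, ?_⟩
    · apply aestronglyMeasurable_of_tendsto_ae (u := atTop) 
        (f := fun m θ => ∑ k ∈ Finset.range m, F k θ)
      · intro m
        exact (continuous_finset_sum _ fun k _ => hFc k).aestronglyMeasurable
      · filter_upwards [hae] with θ hθ
        exact hθ.hasSum.tendsto_sum_nat
    · refine lt_of_le_of_lt (lintegral_mono fun θ => ?_) (lt_top_iff_ne_top.2 hlint)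
      exact enorm_tsum_le_tsum_enorm
  have hto : (fun θ : ℝ => (sumFn T (a + circleMap c r θ • b)).toReal) = fun θ => ∑' k, F k θ := by
    ext θ; rw [sumFn_toReal]
  unfold circleAvg
  rw [if_pos]
  · simp only [hto]
    rw [sumFn, if_pos hs, EReal.coe_le_coe_iff, intervalIntegral.integral_of_le hpi.le]
    exact hasSum_le hmean hs.hasSum (hsum.div_const _)
  · simp only [hto]
    refine ⟨?_, ?_⟩
    · rw [intervalIntegrable_iff_integrableOn_Ioc_of_le hpi.le]; exact hintegr
    · filter_upwards [hae] with θ hθ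
      exact sumFn_ne_bot.2 hθ

theorem complete_of_sum {Ω S : Set (ℂ × ℂ)} (hΩ : IsOpen Ω) (hconn : IsPreconnected Ω)
    (hgood : ∀ k, ∀ p ∈ Ω, Good (T k) p)
    (hneg : ∀ K ⊆ Ω, IsCompact K → ∀ᶠ k in atTop, ∀ p ∈ K, T k p ≤ 0)
    (hS : ∀ p ∈ S, ∀ᶠ k in atTop, T k p ≤ -1)
    (hnS : ∀ p ∈ Ω, p ∉ S → Summable (fun k => T k p))
    (hex : ∃ p ∈ Ω, p ∉ S) : CompletePluripolarIn S Ω := by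
  refine ⟨sumFn T, ⟨?_, ?_, ?_, ?_⟩, ?_⟩
  · intro z _
    unfold sumFn
    split_ifs <;> simp
  · intro p hp y hy
    obtain ⟨K, hKn, hKΩ, hKc⟩ := local_compact_nhds (hΩ.mem_nhds hp)
    obtain ⟨n, hn⟩ := eventually_atTop.1 (hneg K hKΩ hKc)
    obtain ⟨m, hm, hlt⟩ := exists_sum_lt (fun k hk => hn k hk p (mem_of_mem_nhds hKn)) hy
    have hc : ContinuousAt (fun q => ((∑ k ∈ Finset.range m, T k q : ℝ) : EReal)) p := by
      apply continuous_coe_real_ereal.continuousAt.comp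
      exact tendsto_finsetSum _ (fun k _ => (hgood k p hp).1)
    apply eventually_nhdsWithin_of_eventually_nhds
    filter_upwards [hc.eventually_lt_const hlt, hKn] with q hq hqK
    exact (sumFn_le (fun k hk => hn k (hm.trans hk) q hqK)).trans_lt hq
  · intro z hz
    obtain ⟨p, hp, hpS⟩ := hex
    refine ⟨p, ?_, sumFn_ne_bot.2 (hnS p hp hpS)⟩
    rw [hconn.connectedComponentIn hz]; exact hp
  · intro a b c r hr h
    exact sumFn_submean hgood hneg a b c r hr h
  · intro z hz
    constructor
    · intro h
      by_contra hzS
      exact sumFn_ne_bot.2 (hnS z hz hzS) h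
    · intro h
      by_contra hne
      have hs := sumFn_ne_bot.1 hne
      have h0 := hs.tendsto_atTop_zero
      have h1 : ∀ᶠ k in atTop, -1 < T k z := h0.eventually_const_lt (by norm_num)
      obtain ⟨k, hk1, hk2⟩ := (h1.and (hS z h)).exists
      linarith

end Sum


lemma fekete {B : Set ℂ} (hB : IsCompact B) (hne : B.Nonempty) {R0 : ℝ}
    (hR0 : ∀ z ∈ B, ‖z‖ ≤ R0) {δ : ℝ} (hδ : 0 < δ) (hδ1 : δ ≤ 1) (n : ℕ) (hn : 1 ≤ n) (t : ℝ)
    (hneg : ∀ x : Fin n → ℂ, (∀ i, x i ∈ B) → ∃ z ∈ B, Real.exp (-t * n) < ∏ i, ‖z - x i‖) :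
    ∃ x : Fin n → ℂ, (∀ i, x i ∈ B) ∧ ∀ y : ℂ,
      -t * n - n * Real.log 2 - Real.log (2 * R0 + 1) + Real.log δ ≤
        ∑ j, Real.log (max ‖y - x j‖ δ) := by
  set L : ℂ → ℂ → ℝ := fun a b => Real.log (max ‖a - b‖ δ) with hL
  have hpos : ∀ a b : ℂ, 0 < max ‖a - b‖ δ := fun a b => lt_max_of_lt_right hδ
  have hLsymm : ∀ a b, L a b = L b a := fun a b => by simp only [hL, norm_sub_rev]
  have hLself : ∀ a, L a a = Real.log δ := fun a => by simp [hL, hδ.le]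
  have hcompact : IsCompact (Set.pi univ (fun _ : Fin n => B)) := isCompact_univ_pi fun _ => hB
  obtain ⟨b0, hb0⟩ := hne
  have hcont : Continuous (fun x : Fin n → ℂ => ∑ i, ∑ j, L (x i) (x j)) := by
    refine continuous_finsetSum _ fun i _ => continuous_finsetSum _ fun j _ => ?_
    exact Continuous.log (by fun_prop) (fun x => (hpos _ _).ne')
  obtain ⟨x, hx, hmax⟩ := hcompact.exists_isMaxOn ⟨fun _ => b0, fun _ _ => hb0⟩ hcont.continuousOn
  have hxB : ∀ i, x i ∈ B := fun i => hx i (mem_univ i)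
  have hsplit : ∀ (y : Fin n → ℂ) (i : Fin n), ∑ a, ∑ b, L (y a) (y b) =
      Real.log δ + 2 * ∑ j ∈ Finset.univ.erase i, L (y i) (y j) +
        ∑ a ∈ Finset.univ.erase i, ∑ b ∈ Finset.univ.erase i, L (y a) (y b) := by
    intro y i
    rw [← Finset.add_sum_erase _ _ (Finset.mem_univ i),
      ← Finset.add_sum_erase _ _ (Finset.mem_univ i)]
    have : ∀ a, ∑ b, L (y a) (y b) = L (y a) (y i) + ∑ b ∈ Finset.univ.erase i, L (y a) (y b) :=
      fun a => (Finset.add_sum_erase _ _ (Finset.mem_univ i)).symm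
    simp only [this, Finset.sum_add_distrib, hLself]
    simp only [hLsymm _ (y i)]
    ring
  have hvar : ∀ i, ∀ z ∈ B, ∑ j ∈ Finset.univ.erase i, L z (x j) ≤
      ∑ j ∈ Finset.univ.erase i, L (x i) (x j) := by
    intro i z hz
    have h1 := hmax (a := Function.update x i z) (by
      intro j _
      by_cases h : j = i
      · subst h; simpa using hz
      · simpa [h] using hxB j)
    simp only [mem_ofPred_eq] at h1
    rw [hsplit _ i, hsplit _ i] at h1
    have e1 : ∑ j ∈ Finset.univ.erase i, L (Function.update x i z i) (Function.update x i z j) =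
        ∑ j ∈ Finset.univ.erase i, L z (x j) := by
      refine Finset.sum_congr rfl fun j hj => ?_
      simp [Finset.ne_of_mem_erase hj]
    have e2 : ∑ a ∈ Finset.univ.erase i, ∑ b ∈ Finset.univ.erase i,
        L (Function.update x i z a) (Function.update x i z b) =
        ∑ a ∈ Finset.univ.erase i, ∑ b ∈ Finset.univ.erase i, L (x a) (x b) := by
      refine Finset.sum_congr rfl fun a ha => Finset.sum_congr rfl fun b hb => ?_
      simp [Finset.ne_of_mem_erase ha, Finset.ne_of_mem_erase hb]
    rw [e1, e2] at h1
    linarith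
  have hat : ∀ i, -t * n - Real.log (2 * R0 + 1) + Real.log δ ≤ ∑ j, L (x i) (x j) := by
    intro i
    obtain ⟨z, hz, hlt⟩ := hneg x hxB
    have hprod : ∀ j, ‖z - x j‖ ≠ 0 := by
      intro j hj
      have : ∏ i, ‖z - x i‖ = 0 := Finset.prod_eq_zero (Finset.mem_univ j) hj
      rw [this] at hlt
      exact absurd hlt (not_lt.2 (Real.exp_pos _).le)
    have h1 : -t * n ≤ ∑ j, Real.log ‖z - x j‖ := by
      rw [← Real.log_prod (fun j _ => hprod j)]
      rw [← Real.log_exp (-t * n)]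
      exact Real.log_le_log (Real.exp_pos _) hlt.le
    have h2 : ∑ j, Real.log ‖z - x j‖ ≤ ∑ j, L z (x j) := by
      refine Finset.sum_le_sum fun j _ => ?_
      exact Real.log_le_log (lt_of_le_of_ne (norm_nonneg _) (hprod j).symm) (le_max_left _ _)
    have h3 := hvar i z hz
    have h4 : L z (x i) ≤ Real.log (2 * R0 + 1) := by
      apply Real.log_le_log (hpos _ _)
      have a1 := norm_sub_le z (x i)
      have a2 := hR0 z hz
      have a3 := hR0 _ (hxB i)
      have := norm_nonneg z
      apply max_le <;> linarith
    rw [← Finset.add_sum_erase _ _ (Finset.mem_univ i)] at h2 ⊢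
    rw [hLself]
    rw [← Finset.add_sum_erase _ _ (Finset.mem_univ i)] at h1
    rw [← Finset.add_sum_erase (a := i) _ (fun j => L z (x j)) (Finset.mem_univ i)] at h2
    linarith
  refine ⟨x, hxB, fun y => ?_⟩
  have : Nonempty (Fin n) := ⟨⟨0, hn⟩⟩
  obtain ⟨i, hi⟩ := Finite.exists_min (fun j => ‖y - x j‖)
  have h5 : ∀ j, L (x i) (x j) - Real.log 2 ≤ Real.log (max ‖y - x j‖ δ) := by
    intro j
    rw [sub_le_iff_le_add, ← Real.log_mul (hpos _ _).ne' (by norm_num)]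
    apply Real.log_le_log (hpos _ _)
    have a1 : ‖x i - x j‖ ≤ ‖y - x i‖ + ‖y - x j‖ := by
      rw [norm_sub_rev y (x i)]
      have := norm_add_le (x i - y) (y - x j)
      simpa using this
    have a2 := hi j
    have a3 := le_max_left ‖y - x j‖ δ
    have a4 := le_max_right ‖y - x j‖ δ
    apply max_le <;> linarith
  have h6 := Finset.sum_le_sum fun j (_ : j ∈ Finset.univ) => h5 j
  have h7 := hat i
  simp only [Finset.sum_sub_distrib, Finset.sum_const, Finset.card_univ, Fintype.card_fin,
    nsmul_eq_mul] at h6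
  linarith

/-- at an interior maximum of `u + k`, `k` is super-mean -/
lemma submean_max {u : ℂ → EReal} (hu : SubharmonicOn u univ) {X : Set ℂ} {k : ℂ → ℝ}
    (hk : ContinuousOn k X) {z1 : ℂ} (hbot : u z1 ≠ ⊥)
    (hmax : ∀ z ∈ X, u z + k z ≤ u z1 + k z1) {r : ℝ} (hr : 0 < r) (hX : closedBall z1 r ⊆ X) :
    Real.circleAverage k z1 r ≤ k z1 := by
  have hpi := Real.two_pi_pos
  have h := hu.2.2.2 0 1 z1 r hr (by simp)
  simp only [smul_eq_mul, mul_one, zero_add] at h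
  unfold circleAvg at h
  split_ifs at h with hc
  swap
  · exact absurd (le_bot_iff.1 h) hbot
  obtain ⟨hi, hae⟩ := hc
  have htop : ∀ z, u z ≠ ⊤ := fun z => hu.1 z (mem_univ z)
  obtain ⟨U1, hU1⟩ : ∃ U : ℝ, u z1 = U := ⟨(u z1).toReal, (EReal.coe_toReal (htop _) hbot).symm⟩
  rw [hU1, EReal.coe_le_coe_iff] at h
  have hkc : Continuous (fun θ => k (circleMap z1 r θ)) :=
    hk.comp_continuous (continuous_circleMap z1 r)
      (fun θ => hX (circleMap_mem_closedBall z1 hr.le θ))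
  have hki : IntervalIntegrable (fun θ => k (circleMap z1 r θ)) volume 0 (2 * Real.pi) :=
    hkc.intervalIntegrable _ _
  have hle : ∫ θ in (0:ℝ)..(2 * Real.pi), ((u (circleMap z1 r θ)).toReal + k (circleMap z1 r θ)) ≤
      ∫ θ in (0:ℝ)..(2 * Real.pi), (U1 + k z1) := by
    rw [intervalIntegral.integral_of_le hpi.le, intervalIntegral.integral_of_le hpi.le]
    apply integral_mono_ae
    · exact (hi.add hki).1
    · exact integrable_const _
    · filter_upwards [hae] with θ hθ
      have h2 := hmax _ (hX (circleMap_mem_closedBall z1 hr.le θ))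
      rw [hU1, ← EReal.coe_toReal (htop _) hθ] at h2
      exact_mod_cast h2
  rw [intervalIntegral.integral_add hi hki, intervalIntegral.integral_const] at hle
  rw [Real.circleAverage, smul_eq_mul, inv_mul_eq_div, div_le_iff₀ hpi]
  rw [le_div_iff₀ hpi] at h
  simp only [sub_zero, smul_eq_mul] at hle
  linarith

lemma avg_strict {n : ℕ} (x : Fin n → ℂ) {δ : ℝ} (hδ : 0 < δ) (c κ : ℝ) (hκ : 0 < κ) {z1 : ℂ} {r : ℝ}
    (hr : 0 < r) (hfar : ∀ z ∈ closedBall z1 r, ∀ j, δ ≤ ‖z - x j‖) {k : ℂ → ℝ}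
    (hk : ∀ z, k z = c * ∑ j, Real.log (max ‖z - x j‖ δ) + κ * ‖z‖ ^ 2) :
    k z1 < Real.circleAverage k z1 r := by
  have hne : ∀ z ∈ closedBall z1 r, ∀ j, z - x j ≠ 0 := fun z hz j h => by
    have := hfar z hz j; simp [h] at this; linarith
  let Q : ℂ → ℂ := fun z => ∏ j, (z - x j)
  have hQ : ∀ z ∈ closedBall z1 r, ∑ j, Real.log (max ‖z - x j‖ δ) = Real.log ‖Q z‖ := by
    intro z hz
    simp only [Q, norm_prod]
    rw [Real.log_prod (fun j _ => by simpa using hne z hz j)]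
    refine Finset.sum_congr rfl fun j _ => ?_
    rw [max_eq_left (hfar z hz j)]
  let q : ℂ → ℂ := fun z => ((κ * (r ^ 2 + ‖z1‖ ^ 2) : ℝ) : ℂ) + (2 * κ : ℝ) * ((starRingEnd ℂ) z1 * (z - z1))
  have hq : Differentiable ℂ q := by fun_prop
  have hharm : InnerProductSpace.HarmonicOnNhd (c • (fun z => Real.log ‖Q z‖) + fun z => (q z).re)
      (closedBall z1 |r|) := by
    intro z hz
    rw [abs_of_pos hr] at hz
    refine InnerProductSpace.HarmonicAt.add (InnerProductSpace.HarmonicAt.const_smul ?_) (hq.analyticAt z).harmonicAt_re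
    have hQd : Differentiable ℂ Q := by fun_prop
    refine (hQd.analyticAt z).harmonicAt_log_norm ?_
    exact Finset.prod_ne_zero_iff.2 fun j _ => hne z hz j
  have havg := hharm.circleAverage_eq
  have hcongr : Real.circleAverage k z1 r =
      Real.circleAverage (c • (fun z => Real.log ‖Q z‖) + fun z => (q z).re) z1 r := by
    apply Real.circleAverage_congr_sphere
    intro z hz
    rw [abs_of_pos hr] at hz
    have hz' := sphere_subset_closedBall hz
    rw [hk, hQ z hz']
    simp only [Pi.add_apply, Pi.smul_apply, smul_eq_mul]
    congr 1
    have h1 : ‖z - z1‖ = r := by simpa [dist_eq_norm] using hz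
    have h2 : ‖z‖ ^ 2 = ‖z1‖ ^ 2 + r ^ 2 + 2 * ((starRingEnd ℂ) z1 * (z - z1)).re := by
      rw [← h1, ← Complex.normSq_eq_norm_sq, ← Complex.normSq_eq_norm_sq, ← Complex.normSq_eq_norm_sq]
      simp [Complex.normSq_apply]
      ring
    simp only [q, Complex.add_re, Complex.re_ofReal_mul, Complex.ofReal_re]
    rw [h2]; ring
  rw [hcongr, havg, hk, hQ z1 (mem_closedBall_self hr.le)]
  simp only [Pi.add_apply, Pi.smul_apply, smul_eq_mul]
  have : (q z1).re = κ * (r ^ 2 + ‖z1‖ ^ 2) := by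
    simp only [q, sub_self, mul_zero, add_zero, Complex.ofReal_re]
  rw [this]
  have : 0 < κ * r ^ 2 := by positivity
  linarith


theorem chebyshev {u : ℂ → EReal} (hu : SubharmonicOn u univ) {B : Set ℂ} (hB : IsCompact B)
    (hne : B.Nonempty) (huB : ∀ z ∈ B, u z = ⊥) (t : ℝ) :
    ∃ n : ℕ, 1 ≤ n ∧ ∃ x : Fin n → ℂ, (∀ i, x i ∈ B) ∧
      ∀ z ∈ B, ∏ i, ‖z - x i‖ ≤ Real.exp (-t * n) := by
  by_contra! hneg
  have htop : ∀ z, u z ≠ ⊤ := fun z => hu.1 z (mem_univ z)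
  obtain ⟨z0, -, hz0⟩ := hu.2.2.1 0 (mem_univ 0)
  obtain ⟨U0, hU0⟩ : ∃ U : ℝ, u z0 = U := ⟨(u z0).toReal, (EReal.coe_toReal (htop _) hz0).symm⟩
  obtain ⟨R0, hR0pos, hR0⟩ : ∃ R0 > 0, ∀ z ∈ B, ‖z‖ ≤ R0 := hB.isBounded.exists_pos_norm_le
  have husc : UpperSemicontinuous u := upperSemicontinuousOn_univ_iff.1 hu.2.1
  set a := Real.log (‖z0‖ + R0 + 1) with ha
  have hapos : 0 < ‖z0‖ + R0 + 1 := by positivity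
  have hea : Real.exp a = ‖z0‖ + R0 + 1 := Real.exp_log hapos
  have hea3 : ‖z0‖ + R0 + 1 ≤ Real.exp (a + 3) := by
    rw [← hea]; exact Real.exp_le_exp.2 (by linarith)
  set R := R0 + Real.exp (a + 3) with hR
  have hz0n := norm_nonneg z0
  have hRpos : 0 < R := by linarith
  have hz0R : ‖z0‖ < R := by linarith
  obtain ⟨Mu, hMu⟩ : ∃ Mu : ℝ, ∀ z ∈ closedBall (0:ℂ) R, u z ≤ Mu := by
    obtain ⟨m, hm, hmm⟩ := (husc.upperSemicontinuousOn (closedBall (0:ℂ) R)).exists_isMaxOn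
      ⟨0, mem_closedBall_self hRpos.le⟩ (isCompact_closedBall _ _)
    refine ⟨(u m).toReal, fun z hz => (hmm hz).trans (EReal.le_coe_toReal (htop m))⟩
  have hMuU : U0 ≤ Mu := by
    have := hMu z0 (by simpa using hz0R.le)
    rw [hU0] at this; exact_mod_cast this
  set ε := 1 / (Mu - U0 + 1) with hε
  have hεpos : 0 < ε := by apply one_div_pos.2; linarith
  have hεM : ε * Mu ≤ ε * U0 + 1 := by
    have : ε * (Mu - U0 + 1) = 1 := by
      rw [hε]; field_simp [show Mu - U0 + 1 ≠ 0 by linarith]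
    nlinarith
  set κ := 1 / R ^ 2 with hκ
  have hκpos : 0 < κ := by positivity
  have hκR : ∀ z ∈ closedBall (0:ℂ) R, κ * ‖z‖ ^ 2 ≤ 1 := by
    intro z hz
    have hz' : ‖z‖ ≤ R := by simpa using hz
    rw [hκ, one_div, inv_mul_le_iff₀ (by positivity), mul_one]
    exact pow_le_pow_left₀ (norm_nonneg _) hz' 2
  set N := (t + Real.log 2 + 3 + a) / ε - U0 with hN
  have hεN : ε * N = t + Real.log 2 + 3 + a - ε * U0 := by
    rw [hN, mul_sub, mul_div_cancel₀ _ hεpos.ne']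
  have hO : IsOpen ({z | u z < ((-N : ℝ) : EReal)} ∩ {z0}ᶜ) :=
    (husc.isOpen_preimage _).inter isOpen_compl_singleton
  have hBO : B ⊆ {z | u z < ((-N : ℝ) : EReal)} ∩ {z0}ᶜ := by
    intro z hz
    refine ⟨?_, ?_⟩
    · simp only [mem_ofPred_eq, huB z hz]; exact EReal.bot_lt_coe _
    · rintro rfl; exact hz0 (huB _ hz)
  obtain ⟨dzr, hdz, hdzO⟩ := hB.exists_cthickening_subset_open hO hBO
  set δ := min dzr 1 with hδ
  have hδpos : 0 < δ := lt_min hdz one_pos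
  have hδ1 : δ ≤ 1 := min_le_right _ _
  have hδO : cthickening δ B ⊆ {z | u z < ((-N : ℝ) : EReal)} ∩ {z0}ᶜ :=
    (cthickening_mono (min_le_left _ _) B).trans hdzO
  obtain ⟨n0, hn0⟩ := exists_nat_ge (Real.log (2 * R0 + 1) - Real.log δ)
  set n := n0 + 1 with hn
  have hnpos : (0:ℝ) < n := by positivity
  have hn0' : Real.log (2 * R0 + 1) - Real.log δ ≤ n := by
    rw [hn]; push_cast; linarith
  obtain ⟨x, hxB, hxlow⟩ := fekete hB hne hR0 hδpos hδ1 n (by omega) t (hneg n (by omega))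
  set k : ℂ → ℝ := fun z => (-(1 / (n * ε))) * ∑ j, Real.log (max ‖z - x j‖ δ) + (κ / ε) * ‖z‖ ^ 2
    with hk
  set S : ℂ → ℝ := fun z => ∑ j, Real.log (max ‖z - x j‖ δ) with hS
  have hεk : ∀ z, ε * k z = -(S z / n) + κ * ‖z‖ ^ 2 := by
    intro z; simp only [hk, hS]; field_simp
  have hkc : Continuous k := by
    have : ∀ j, Continuous fun z : ℂ => Real.log (max ‖z - x j‖ δ) := fun j =>
      Continuous.log (by fun_prop) fun z => (lt_max_of_lt_right hδpos).ne'
    have := continuous_finsetSum Finset.univ (fun j _ => this j)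
    fun_prop
  set X := closedBall (0:ℂ) R \ thickening δ B with hX
  have hXc : IsCompact X := (isCompact_closedBall _ _).diff isOpen_thickening
  have hz0X : z0 ∈ X := by
    refine ⟨by simpa using hz0R.le, fun h => ?_⟩
    exact (hδO (thickening_subset_cthickening _ _ h)).2 rfl
  have husck : UpperSemicontinuousOn (fun z => u z + (k z : EReal)) X := by
    apply UpperSemicontinuousOn.add' (husc.upperSemicontinuousOn _)
    · exact (continuous_coe_real_ereal.comp hkc).upperSemicontinuous.upperSemicontinuousOn _
    · intro z _
      exact EReal.continuousAt_add (Or.inl (htop z)) (Or.inr (EReal.coe_ne_top _))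
  obtain ⟨z1, hz1X, hz1max⟩ := husck.exists_isMaxOn ⟨z0, hz0X⟩ hXc
  have h01 := hz1max hz0X
  simp only [mem_ofPred_eq] at h01
  have hz1bot : u z1 ≠ ⊥ := by
    intro h
    rw [h, hU0, EReal.bot_add] at h01
    have := le_bot_iff.1 h01
    rw [← EReal.coe_add] at this
    exact EReal.coe_ne_bot _ this
  obtain ⟨U1, hU1⟩ : ∃ U : ℝ, u z1 = U := ⟨(u z1).toReal, (EReal.coe_toReal (htop _) hz1bot).symm⟩
  have h01' : U0 + k z0 ≤ U1 + k z1 := by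
    rw [hU0, hU1] at h01; exact_mod_cast h01
  have h01'' : ε * U0 + ε * k z0 ≤ ε * U1 + ε * k z1 := by nlinarith
  have hS0 : S z0 / n ≤ a := by
    rw [div_le_iff₀ hnpos]
    have : S z0 ≤ ∑ j : Fin n, a := by
      refine Finset.sum_le_sum fun j _ => Real.log_le_log (lt_max_of_lt_right hδpos) ?_
      have := norm_sub_le z0 (x j)
      have := hR0 _ (hxB j)
      apply max_le <;> linarith
    simpa [mul_comm] using this
  have hlow : ∀ y, -(S y / n) ≤ t + Real.log 2 + 1 := by
    intro y
    have := hxlow y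
    rw [← neg_div, div_le_iff₀ hnpos]
    have e : S y = ∑ j, Real.log (max ‖y - x j‖ δ) := rfl
    nlinarith
  have hpos0 : 0 ≤ κ * ‖z0‖ ^ 2 := by positivity
  have hk1 := hκR z1 hz1X.1
  rw [hεk, hεk] at h01''
  have hz1R : ‖z1‖ ≤ R := by simpa using hz1X.1
  rcases hz1R.lt_or_eq with hlt | heq
  swap
  · -- outer boundary
    have h1 : a + 3 ≤ S z1 / n := by
      rw [le_div_iff₀ hnpos]
      have : ∑ j : Fin n, (a + 3) ≤ S z1 := by
        refine Finset.sum_le_sum fun j _ => ?_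
        rw [← Real.log_exp (a + 3)]
        apply Real.log_le_log (Real.exp_pos _)
        refine le_trans ?_ (le_max_left _ _)
        have := norm_sub_norm_le z1 (x j)
        have := hR0 _ (hxB j)
        linarith
      simp only [Finset.sum_const, Finset.card_univ, Fintype.card_fin, nsmul_eq_mul] at this
      linarith
    have h2 : U1 ≤ Mu := by
      have := hMu z1 hz1X.1
      rw [hU1] at this; exact_mod_cast this
    have h3 : ε * U1 ≤ ε * Mu := mul_le_mul_of_nonneg_left h2 hεpos.le
    linarith
  by_cases hth : z1 ∈ cthickening δ B
  · have h1 := (hδO hth).1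
    simp only [mem_ofPred_eq] at h1
    rw [hU1] at h1
    have h2 : U1 < -N := by exact_mod_cast h1
    have h3 : ε * U1 < ε * (-N) := mul_lt_mul_of_pos_left h2 hεpos
    have := hlow z1
    linarith
  · have hop : IsOpen (ball (0:ℂ) R \ cthickening δ B) := isOpen_ball.sdiff isClosed_cthickening
    obtain ⟨r, hr, hrX⟩ := nhds_basis_closedBall.mem_iff.1
      (hop.mem_nhds (show z1 ∈ _ from ⟨by simpa using hlt, hth⟩))
    have hrX' : closedBall z1 r ⊆ X := fun z hz =>
      ⟨ball_subset_closedBall (hrX hz).1, fun h => (hrX hz).2 (thickening_subset_cthickening _ _ h)⟩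
    have h1 := submean_max hu hkc.continuousOn hz1bot (fun z hz => hz1max hz) hr hrX'
    have h2 := avg_strict x hδpos (-(1 / (n * ε))) (κ / ε) (by positivity) hr
      (fun z hz j => by
        by_contra! hcon
        apply (hrX' hz).2
        rw [mem_thickening_iff]
        exact ⟨x j, hxB j, by rwa [dist_eq_norm]⟩) (k := k) (fun z => rfl)
    linarith

/-- A polar set contains no nonempty open set. -/
lemma polar_not_open {A D : Set ℂ} (hA : PolarSet A) (hD : IsOpen D) (hne : D.Nonempty) :
    ∃ z ∈ D, z ∉ A := by
  obtain ⟨u, hu, huA⟩ := hA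
  by_contra! hcon
  obtain ⟨z1, hz1⟩ := hne
  obtain ⟨z0, -, hz0⟩ := hu.2.2.1 0 (mem_univ 0)
  have hne : z0 ≠ z1 := by rintro rfl; exact hz0 (huA _ (hcon _ hz1))
  have hr : 0 < dist z1 z0 := dist_pos.2 hne.symm
  have h := hu.2.2.2 0 1 z0 (dist z1 z0) hr (by simp)
  simp only [smul_eq_mul, mul_one, zero_add] at h
  unfold circleAvg at h
  split_ifs at h with hc
  swap
  · exact hz0 (le_bot_iff.1 h)
  have hae := hc.2
  have hz1s : z1 ∈ circleMap z0 (dist z1 z0) '' Ioc 0 (2 * Real.pi) := by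
    rw [image_circleMap_Ioc, abs_of_pos hr]; exact mem_sphere.2 rfl
  obtain ⟨θ, hθ, hθz⟩ := hz1s
  have hV : IsOpen ((circleMap z0 (dist z1 z0)) ⁻¹' D) := hD.preimage (continuous_circleMap _ _)
  have hθV : θ ∈ (circleMap z0 (dist z1 z0)) ⁻¹' D := by simp [hθz, hz1]
  have hcl : θ ∈ closure (Ioo 0 (2 * Real.pi)) := by
    rw [closure_Ioo Real.two_pi_pos.ne]; exact Ioc_subset_Icc_self hθ
  obtain ⟨φ, hφV, hφ⟩ := mem_closure_iff.1 hcl _ hV hθV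
  have hpos : 0 < volume ((circleMap z0 (dist z1 z0)) ⁻¹' D ∩ Ioo 0 (2 * Real.pi)) :=
    (hV.inter isOpen_Ioo).measure_pos _ ⟨φ, hφV, hφ⟩
  rw [ae_restrict_iff' measurableSet_Ioc, ae_iff] at hae
  refine hpos.ne' (measure_mono_null ?_ hae)
  rintro ψ ⟨h1, h2⟩
  simp only [mem_ofPred_eq, Classical.not_imp, not_not]
  exact ⟨Ioo_subset_Ioc_self h2, huA _ (hcon _ h1)⟩


/-- A continuous subharmonic exhaustion function of a plane open set. -/
noncomputable def rho (D : Set ℂ) (z : ℂ) : ℝ :=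
  max (Real.log (max ‖z‖ 1)) (-Real.log (infDist z Dᶜ))

lemma infDist_compl_pos {D : Set ℂ} (hD : IsOpen D) (hne : (Dᶜ).Nonempty) {z : ℂ} (hz : z ∈ D) :
    0 < infDist z Dᶜ :=
  (hD.isClosed_compl.notMem_iff_infDist_pos hne).1 (by simpa using hz)

lemma good_rho {D : Set ℂ} (hD : IsOpen D) {p : ℂ × ℂ} (hp : p.1 ∈ D) :
    Good (fun x => rho D x.1) p := by
  unfold rho
  refine Good.max (Good.log_max (G := fun x : ℂ × ℂ => x.1) analyticAt_fst one_pos) ?_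
  rcases (Dᶜ).eq_empty_or_nonempty with h | h
  · rw [h]; simpa using Good.const 0 p
  have hpos := infDist_compl_pos hD h hp
  have hcont : ContinuousAt (fun x : ℂ × ℂ => infDist x.1 Dᶜ) p :=
    ((continuous_infDist_pt _).comp continuous_fst).continuousAt
  refine ⟨(hcont.log hpos.ne').neg, fun b => ?_⟩
  obtain ⟨a, ha, hda⟩ := hD.isClosed_compl.exists_infDist_eq_dist h p.1
  have hne : p.1 - a ≠ 0 := by
    intro h0
    rw [hda, sub_eq_zero.1 h0, dist_self] at hpos
    exact lt_irrefl _ hpos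
  have hs : SuppAt (fun l : ℂ => -Real.log ‖p.1 + l * b.1 - a‖) 0 :=
    SuppAt.neg_log_norm (g := fun l : ℂ => p.1 + l * b.1 - a) (by fun_prop) (by simpa using hne)
  refine hs.of_le ?_ ?_
  · have hev : ∀ᶠ l : ℂ in 𝓝 0, (p + l • b).1 ∈ D :=
      (tendsto_line p b).eventually ((hD.preimage continuous_fst).mem_nhds hp)
    filter_upwards [hev] with l hl
    have h1 := infDist_compl_pos hD h hl
    have h2 := infDist_le_dist_of_mem (x := (p + l • b).1) ha
    have h3 := Real.log_le_log h1 h2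
    rw [dist_eq_norm] at h3
    simp only [Prod.fst_add, Prod.smul_fst, smul_eq_mul] at h3 ⊢
    linarith
  · simp [hda, dist_eq_norm]

lemma rho_nonneg (D : Set ℂ) (z : ℂ) : 0 ≤ rho D z :=
  le_trans (Real.log_nonneg (le_max_right _ _)) (le_max_left _ _)

lemma norm_le_of_rho {D : Set ℂ} {z : ℂ} {R : ℝ} (h : rho D z ≤ R) : ‖z‖ ≤ Real.exp R := by
  have h1 : Real.log (max ‖z‖ 1) ≤ R := le_trans (le_max_left _ _) h
  have h2 : (0:ℝ) < max ‖z‖ 1 := lt_max_of_lt_right one_pos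
  exact le_trans (le_max_left _ _) ((Real.log_le_iff_le_exp h2).1 h1)

lemma compact_rho {D : Set ℂ} (hD : IsOpen D) (R : ℝ) : IsCompact {z | z ∈ D ∧ rho D z ≤ R} := by
  refine Metric.isCompact_of_isClosed_isBounded ?_ ?_
  · have hc : Continuous fun z : ℂ => Real.log (max ‖z‖ 1) := by
      refine Continuous.log (by fun_prop) fun z => ?_
      exact (lt_max_of_lt_right one_pos).ne'
    have h1 : IsClosed {z : ℂ | Real.log (max ‖z‖ 1) ≤ R} := isClosed_le hc continuous_const
    rcases (Dᶜ).eq_empty_or_nonempty with h | h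
    · have hu : D = univ := compl_empty_iff.1 h
      rcases le_or_gt 0 R with hR | hR
      · convert h1 using 1
        ext z
        simp [rho, hu, hR]
      · convert isClosed_empty using 1
        ext z
        simp only [mem_ofPred_eq, mem_empty_iff_false, iff_false, not_and, not_le]
        intro _
        exact lt_of_lt_of_le hR (rho_nonneg D z)
    · have h2 : IsClosed {z : ℂ | Real.exp (-R) ≤ infDist z Dᶜ} :=
        isClosed_le continuous_const (continuous_infDist_pt _)
      convert h1.inter h2 using 1
      ext z
      simp only [mem_ofPred_eq, mem_inter_iff, rho, max_le_iff]
      constructor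
      · rintro ⟨hz, h3, h4⟩
        refine ⟨h3, ?_⟩
        rw [← Real.le_log_iff_exp_le (infDist_compl_pos hD h hz)]
        linarith
      · rintro ⟨h3, h4⟩
        have hpos : 0 < infDist z Dᶜ := lt_of_lt_of_le (Real.exp_pos _) h4
        refine ⟨?_, h3, ?_⟩
        · by_contra hz
          rw [infDist_zero_of_mem (show z ∈ Dᶜ from hz)] at hpos
          exact lt_irrefl _ hpos
        · rw [← Real.le_log_iff_exp_le hpos] at h4
          linarith
  · refine (isBounded_closedBall (x := (0:ℂ)) (r := Real.exp R)).subset fun z hz => ?_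
    simpa using norm_le_of_rho hz.2

lemma poly_data {A B : Set ℂ} (hA : PolarSet A) (hBA : B ⊆ A) (hB : IsCompact B) (t : ℝ) :
    ∃ c : ℝ, 0 < c ∧ ∃ n : ℕ, c * n ≤ 1 ∧ ∃ x : Fin n → ℂ, (∀ i, x i ∈ B) ∧
      ∀ z ∈ B, ∏ i, ‖z - x i‖ ≤ Real.exp (-t / c) := by
  rcases B.eq_empty_or_nonempty with h | h
  · exact ⟨1, one_pos, 0, by simp, fun i => i.elim0, fun i => i.elim0, by simp [h]⟩
  obtain ⟨u, hu, huA⟩ := hA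
  obtain ⟨n, hn, x, hx, hz⟩ := chebyshev hu hB h (fun z hz => huA z (hBA hz)) t
  have hn' : (0:ℝ) < n := by exact_mod_cast hn
  refine ⟨1 / n, by positivity, n, by field_simp; rfl, x, hx, fun z hzB => ?_⟩
  have := hz z hzB
  simpa using this


lemma step {D A : Set ℂ} {f : ℂ → ℂ} (hD : IsOpen D)
    (hAD : A ⊆ D) (hAclosed : ∀ z ∈ D, z ∈ closure A → z ∈ A)
    (hApolar : PolarSet A) (hf : DifferentiableOn ℂ f (D \ A)) (k : ℕ) {t : ℝ} (ht : 0 ≤ t) :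
    ∃ V : ℂ × ℂ → ℝ, (∀ p : ℂ × ℂ, p.1 ∈ D → Good V p) ∧
      (∀ p : ℂ × ℂ, p.1 ∈ D → rho D p.1 ≤ k → V p ≤ k + 3 + Real.log (max ‖p.2‖ 1)) ∧
      (∀ p : ℂ × ℂ, p.1 ∈ A → rho D p.1 ≤ k - 1 → V p ≤ -t + Real.log (max ‖p.2‖ 1)) ∧
      (∀ z ∈ D \ A, rho D z ≤ k - 1 → V (z, f z) ≤ -t + Real.log (max ‖f z‖ 1)) ∧
      (∀ z ∈ D \ A, ∀ w, w ≠ f z → ∀ d : ℝ, 0 < d → d ≤ 1 → (∀ a ∈ A, d ≤ ‖z - a‖) →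
        -t - 1 < Real.log d → rho D z < k + 1 →
        Real.log d + min 0 (Real.log ‖w - f z‖) ≤ V (z, w)) := by
  classical
  have hDA : IsOpen (D \ A) := by
    have : D \ A = D \ closure A := by
      ext z
      exact ⟨fun h => ⟨h.1, fun h' => h.2 (hAclosed z h.1 h')⟩,
        fun h => ⟨h.1, fun h' => h.2 (subset_closure h')⟩⟩
    rw [this]; exact hD.sdiff isClosed_closure
  set X : Set ℂ := {z | z ∈ D ∧ rho D z ≤ k + 1} with hX
  have hXc : IsCompact X := compact_rho hD _
  have hBc : IsCompact (X ∩ A) := by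
    have : X ∩ A = X ∩ closure A := by
      ext z
      exact ⟨fun h => ⟨h.1, subset_closure h.2⟩, fun h => ⟨h.1, hAclosed z h.1.1 h.2⟩⟩
    rw [this]; exact hXc.inter_right isClosed_closure
  obtain ⟨c, hc, n, hcn, x, hxB, hxq⟩ := poly_data hApolar inter_subset_right hBc (t + 2)
  set q : ℂ → ℂ := fun z => ∏ i, (z - x i) with hq
  have hqn : ∀ z, ‖q z‖ = ∏ i, ‖z - x i‖ := fun z => by simp [hq]
  have hqd : Differentiable ℂ q := by
    intro z
    simp only [hq]
    fun_prop
  have hqc : Continuous q := hqd.continuous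
  set τ : ℝ := Real.exp (-(t + 1) / c) with hτ
  have hτpos : 0 < τ := Real.exp_pos _
  have hlogτ : c * Real.log τ = -(t + 1) := by
    rw [hτ, Real.log_exp]; field_simp
  have hqA : ∀ z ∈ A, rho D z ≤ k + 1 → ‖q z‖ < τ := by
    intro z hz hr
    rw [hqn]
    refine lt_of_le_of_lt (hxq z ⟨⟨hAD hz, hr⟩, hz⟩) ?_
    rw [hτ, Real.exp_lt_exp]
    exact div_lt_div_of_pos_right (by linarith) hc
  set Y : Set ℂ := X ∩ {z | τ ≤ ‖q z‖} with hY
  have hYc : IsCompact Y := hXc.inter_right (isClosed_le continuous_const hqc.norm)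
  have hYDA : Y ⊆ D \ A := fun z hz => ⟨hz.1.1, fun hA => absurd (hqA z hA hz.1.2) (not_lt.2 hz.2)⟩
  obtain ⟨F, hF0, hF⟩ : ∃ F : ℝ, 0 ≤ F ∧ ∀ z ∈ Y, ‖f z‖ ≤ F := by
    obtain ⟨F, hF⟩ := hYc.exists_bound_of_continuousOn (hf.continuousOn.mono hYDA)
    exact ⟨max F 0, le_max_right _ _, fun z hz => (hF z hz).trans (le_max_left _ _)⟩
  have hlF : 0 ≤ Real.log (1 + F) := Real.log_nonneg (by linarith)
  obtain ⟨η, hη0, hη1, hηF⟩ : ∃ η : ℝ, 0 < η ∧ η ≤ 1 ∧ η * Real.log (1 + F) ≤ 1 / 2 := by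
    refine ⟨1 / (2 * (1 + Real.log (1 + F))), by positivity, ?_, ?_⟩
    · rw [div_le_one (by positivity)]; linarith
    · rw [div_mul_eq_mul_div, div_le_div_iff₀ (by positivity) (by norm_num)]; linarith
  set b : ℝ := k + 2 with hb
  have hk0 : (0:ℝ) ≤ k := Nat.cast_nonneg k
  set δ : ℝ := Real.exp (-(t + b) / η) with hδ
  have hδpos : 0 < δ := Real.exp_pos _
  have hlogδ : η * Real.log δ = -(t + b) := by
    rw [hδ, Real.log_exp]; field_simp
  have hδ1 : δ ≤ 1 := by
    rw [hδ, Real.exp_le_one_iff]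
    exact div_nonpos_of_nonpos_of_nonneg (by linarith) hη0.le
  set hh : ℂ → ℝ := fun z => c * Real.log (max ‖q z‖ τ) with hhh
  set C : ℝ := b + 1 + t with hC
  set v : ℂ × ℂ → ℝ := fun p => hh p.1 + η * Real.log (max ‖p.2 - f p.1‖ δ) with hv
  set s : ℂ × ℂ → ℝ := fun p => η * Real.log (max ‖p.2‖ 1) + max (-t) (C * (rho D p.1 + -k)) with hs
  set W : Set ℂ := {z | z ∈ D ∧ rho D z < k + 1 ∧ τ < ‖q z‖} with hW
  have hWY : W ⊆ Y := fun z hz => ⟨⟨hz.1, hz.2.1.le⟩, hz.2.2.le⟩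
  have hlp : ∀ w : ℂ, 0 ≤ Real.log (max ‖w‖ 1) := fun w => Real.log_nonneg (le_max_right _ _)
  have hηlp : ∀ w : ℂ, η * Real.log (max ‖w‖ 1) ≤ Real.log (max ‖w‖ 1) := fun w =>
    mul_le_of_le_one_left (hlp w) hη1
  -- upper bound for hh
  have hhb : ∀ z ∈ X, hh z ≤ b := by
    intro z hz
    have h1 : ‖q z‖ ≤ Real.exp (n * b) := by
      rw [hqn, Real.exp_nat_mul]
      have : ∏ i : Fin n, ‖z - x i‖ ≤ ∏ i : Fin n, Real.exp b := by
        refine Finset.prod_le_prod (fun _ _ => norm_nonneg _) fun i _ => ?_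
        have e1 := norm_le_of_rho hz.2
        have e2 := norm_le_of_rho (hxB i).1.2
        have e3 := norm_sub_le z (x i)
        have e4 : Real.exp b = Real.exp (k + 1) * Real.exp 1 := by
          rw [← Real.exp_add]; congr 1; rw [hb]; ring
        have e5 : (2:ℝ) ≤ Real.exp 1 := by
          have := Real.add_one_le_exp (1:ℝ); linarith
        have e6 : Real.exp (k + 1 : ℝ) * 2 ≤ Real.exp (k + 1) * Real.exp 1 :=
          mul_le_mul_of_nonneg_left e5 (Real.exp_pos _).le
        linarith
      simpa using this
    have h2 : τ ≤ Real.exp (n * b) := by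
      rw [hτ, Real.exp_le_exp]
      have : -(t + 1) / c ≤ 0 := div_nonpos_of_nonpos_of_nonneg (by linarith) hc.le
      have : (0:ℝ) ≤ n * b := by positivity
      linarith
    have h3 : Real.log (max ‖q z‖ τ) ≤ n * b :=
      (Real.log_le_iff_le_exp (lt_max_of_lt_right hτpos)).2 (max_le h1 h2)
    calc hh z ≤ c * (n * b) := mul_le_mul_of_nonneg_left h3 hc.le
      _ = (c * n) * b := by ring
      _ ≤ 1 * b := mul_le_mul_of_nonneg_right hcn (by positivity)
      _ = b := one_mul b
  have hvY : ∀ p : ℂ × ℂ, p.1 ∈ Y → v p ≤ hh p.1 + 1 / 2 + η * Real.log (max ‖p.2‖ 1) := by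
    intro p hp
    have h1 : (1:ℝ) ≤ max ‖p.2‖ 1 := le_max_right _ _
    have h2 : ‖p.2‖ ≤ max ‖p.2‖ 1 := le_max_left _ _
    have h3 : max ‖p.2 - f p.1‖ δ ≤ (1 + F) * max ‖p.2‖ 1 := by
      have e1 := norm_sub_le p.2 (f p.1)
      have e2 := hF p.1 hp
      have e3 : F * 1 ≤ F * max ‖p.2‖ 1 := mul_le_mul_of_nonneg_left h1 hF0
      apply max_le <;> linarith
    have h4 := Real.log_le_log (lt_max_of_lt_right hδpos) h3
    rw [Real.log_mul (by positivity) (by positivity)] at h4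
    have h5 := mul_le_mul_of_nonneg_left h4 hη0.le
    simp only [hv]
    linarith
  have hs_good : ∀ p : ℂ × ℂ, p.1 ∈ D → Good s p := fun p hp =>
    ((Good.log_max (G := fun x : ℂ × ℂ => x.2) analyticAt_snd one_pos).smul hη0.le).add
      ((Good.const (-t) p).max
        (((good_rho hD hp).add (Good.const (-k) p)).smul (by positivity)))
  have hv_good : ∀ p : ℂ × ℂ, p.1 ∈ D \ A → Good v p := by
    intro p hp
    have hfa : AnalyticAt ℂ f p.1 := hf.analyticAt (hDA.mem_nhds hp)
    have hfa' : AnalyticAt ℂ (fun x : ℂ × ℂ => f x.1) p :=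
      AnalyticAt.fun_comp (g := f) (f := fun x : ℂ × ℂ => x.1) hfa analyticAt_fst
    have hqa' : AnalyticAt ℂ (fun x : ℂ × ℂ => q x.1) p :=
      AnalyticAt.fun_comp (g := q) (f := fun x : ℂ × ℂ => x.1) (hqd.analyticAt _) analyticAt_fst
    exact ((Good.log_max hqa' hτpos).smul hc.le).add
      ((Good.log_max (analyticAt_snd.sub hfa') hδpos).smul hη0.le)
  have hrho_c : ∀ z ∈ D, ContinuousAt (rho D) z := by
    intro z hz
    have h1 := (good_rho (p := (z, 0)) hD hz).1
    have h2 : ContinuousAt (fun z : ℂ => (z, (0:ℂ))) z := by fun_prop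
    exact ContinuousAt.comp (g := fun x : ℂ × ℂ => rho D x.1) (f := fun z : ℂ => (z, (0:ℂ))) h1 h2
  have hWo : IsOpen W := by
    rw [isOpen_iff_mem_nhds]
    intro z hz
    filter_upwards [hD.mem_nhds hz.1, (hrho_c z hz.1).eventually (gt_mem_nhds hz.2.1),
      hqc.norm.continuousAt.eventually (lt_mem_nhds hz.2.2)] with y h1 h2 h3
    exact ⟨h1, h2, h3⟩
  set V : ℂ × ℂ → ℝ := fun p => if p.1 ∈ W then max (v p) (s p) else s p with hV
  have hVW : ∀ p : ℂ × ℂ, p.1 ∈ W → V p = max (v p) (s p) := fun p hp => by simp only [hV, if_pos hp]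
  have hVn : ∀ p : ℂ × ℂ, p.1 ∉ W → V p = s p := fun p hp => by simp only [hV, if_neg hp]
  have hs1 : ∀ p : ℂ × ℂ, rho D p.1 ≤ k - 1 → s p ≤ -t + Real.log (max ‖p.2‖ 1) := by
    intro p hp
    have h1 : C * (rho D p.1 + -k) ≤ C * (-1) :=
      mul_le_mul_of_nonneg_left (by linarith) (by positivity)
    have h2 : max (-t) (C * (rho D p.1 + -k)) ≤ -t := max_le le_rfl (by linarith)
    have := hηlp p.2
    simp only [hs]
    linarith
  refine ⟨V, ?_, ?_, ?_, ?_, ?_⟩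
  · intro p hp
    by_cases hpW : p.1 ∈ W
    · refine ((hv_good p (hYDA (hWY hpW))).max (hs_good p hp)).congr ?_
      filter_upwards [(hWo.preimage continuous_fst).mem_nhds hpW] with y hy
      exact (hVW y hy).symm
    by_cases hpY : p.1 ∈ Y
    · have hlt : v p < s p := by
        have h1 := hvY p hpY
        by_cases hqτ : τ < ‖q p.1‖
        · have h2 : (k:ℝ) + 1 ≤ rho D p.1 := by
            by_contra! h
            exact hpW ⟨hp, h, hqτ⟩
          have h3 := hhb _ hpY.1
          have h4 : C * 1 ≤ C * (rho D p.1 + -k) :=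
            mul_le_mul_of_nonneg_left (by linarith) (by positivity)
          have h5 := le_max_right (-t) (C * (rho D p.1 + -k))
          simp only [hs]
          linarith
        · have h2 : hh p.1 = -(t + 1) := by
            simp only [hhh]
            rw [max_eq_right (not_lt.1 hqτ), hlogτ]
          have h5 := le_max_left (-t) (C * (rho D p.1 + -k))
          simp only [hs]
          linarith
      refine (hs_good p hp).congr ?_
      filter_upwards [(hv_good p (hYDA hpY)).1.eventually_lt (hs_good p hp).1 hlt] with y hy
      by_cases hyW : y.1 ∈ W
      · rw [hVW y hyW, max_eq_right hy.le]
      · rw [hVn y hyW]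
    · refine (hs_good p hp).congr ?_
      filter_upwards [(hYc.isClosed.isOpen_compl.preimage continuous_fst).mem_nhds hpY] with y hy
      exact (hVn y fun h => hy (hWY h)).symm
  · intro p hp hr
    have hsb : s p ≤ k + 3 + Real.log (max ‖p.2‖ 1) := by
      have h1 : C * (rho D p.1 + -k) ≤ 0 :=
        mul_nonpos_of_nonneg_of_nonpos (by positivity) (by linarith)
      have h2 : max (-t) (C * (rho D p.1 + -k)) ≤ 0 := max_le (by linarith) h1
      have := hηlp p.2
      simp only [hs]
      linarith
    by_cases hpW : p.1 ∈ W
    · rw [hVW p hpW]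
      refine max_le ?_ hsb
      have h1 := hvY p (hWY hpW)
      have h2 := hhb _ (hWY hpW).1
      have := hηlp p.2
      linarith
    · rw [hVn p hpW]; exact hsb
  · intro p hp hr
    rw [hVn p fun h => (hYDA (hWY h)).2 hp]
    exact hs1 p hr
  · intro z hz hr
    by_cases hpW : z ∈ W
    · rw [hVW _ hpW]
      refine max_le ?_ (hs1 (z, f z) hr)
      have h2 := hhb _ (hWY hpW).1
      have := hlp (f z)
      simp only [hv, sub_self, norm_zero, max_eq_right hδpos.le]
      linarith
    · rw [hVn _ hpW]; exact hs1 (z, f z) hr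
  · intro z hz w hw d hd hd1 hdA hdt hr
    have hld : Real.log d ≤ 0 := Real.log_nonpos hd.le hd1
    have h1 : d ^ n ≤ ‖q z‖ := by
      rw [hqn]
      have : ∏ i : Fin n, d ≤ ∏ i : Fin n, ‖z - x i‖ :=
        Finset.prod_le_prod (fun _ _ => hd.le) fun i _ => hdA _ (hxB i).2
      simpa using this
    have h2 : n * Real.log d ≤ Real.log ‖q z‖ := by
      rw [← Real.log_pow]; exact Real.log_le_log (by positivity) h1
    have h3 : Real.log d ≤ c * Real.log ‖q z‖ := by
      calc Real.log d ≤ (c * n) * Real.log d := by nlinarith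
        _ = c * (n * Real.log d) := by ring
        _ ≤ _ := mul_le_mul_of_nonneg_left h2 hc.le
    have hqpos : 0 < ‖q z‖ := lt_of_lt_of_le (by positivity) h1
    have h4 : τ < ‖q z‖ := by
      rw [← Real.log_lt_log_iff hτpos hqpos]
      by_contra! hcon
      have := mul_le_mul_of_nonneg_left hcon hc.le
      linarith
    have hzW : z ∈ W := ⟨hz.1, hr, h4⟩
    rw [hVW _ hzW]
    refine le_trans ?_ (le_max_left _ _)
    have h5 : hh z = c * Real.log ‖q z‖ := by simp only [hhh]; rw [max_eq_left h4.le]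
    have hwpos : 0 < ‖w - f z‖ := norm_pos_iff.2 (sub_ne_zero.2 hw)
    have h6 : Real.log ‖w - f z‖ ≤ Real.log (max ‖w - f z‖ δ) :=
      Real.log_le_log hwpos (le_max_left _ _)
    have h7 : min 0 (Real.log ‖w - f z‖) ≤ η * Real.log (max ‖w - f z‖ δ) := by
      have e1 := min_le_left 0 (Real.log ‖w - f z‖)
      have e2 := min_le_right 0 (Real.log ‖w - f z‖)
      calc min 0 (Real.log ‖w - f z‖) ≤ η * min 0 (Real.log ‖w - f z‖) := by nlinarith
        _ ≤ _ := mul_le_mul_of_nonneg_left (e2.trans h6) hη0.le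
    simp only [hv]
    linarith


/-- Let `D ⊆ ℂ` be a domain, `A` a closed polar subset of `D`, and `f`
holomorphic on `D \ A`. Then `Γ_f ∪ (A × ℂ)` is complete pluripolar in `D × ℂ`. -/
theorem statement0 (D A : Set ℂ) (f : ℂ → ℂ)
    (hD : IsOpen D) (hDconn : IsConnected D)
    (hAD : A ⊆ D) (hAclosed : ∀ z ∈ D, z ∈ closure A → z ∈ A)
    (hApolar : PolarSet A)
    (hf : DifferentiableOn ℂ f (D \ A)) :
    CompletePluripolarIn (graphOver f (D \ A) ∪ A ×ˢ (Set.univ : Set ℂ))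
      (D ×ˢ (Set.univ : Set ℂ)) := by

  choose V hVg hVu hVA hVf hVl using fun k : ℕ =>
    step hD hAD hAclosed hApolar hf k (t := 2 ^ k) (by positivity)
  have hnat : ∀ R : ℝ, ∀ᶠ k : ℕ in atTop, R ≤ k := fun R =>
    tendsto_natCast_atTop_atTop.eventually (eventually_ge_atTop R)
  have hpow : ∀ R : ℝ, ∀ᶠ k : ℕ in atTop, R ≤ (2:ℝ) ^ k := fun R =>
    (tendsto_pow_atTop_atTop_of_one_lt one_lt_two).eventually (eventually_ge_atTop R)
  have hscale : ∀ k : ℕ, ∀ y : ℝ, y ≤ -2 ^ k → (1 / 2 : ℝ) ^ k * y ≤ -1 := by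
    intro k y hy
    have h1 := mul_le_mul_of_nonneg_left hy (show (0:ℝ) ≤ (1 / 2) ^ k by positivity)
    have h2 : (1 / 2 : ℝ) ^ k * (2:ℝ) ^ k = 1 := by rw [← mul_pow]; norm_num
    linarith
  refine complete_of_sum (T := fun k p => (1 / 2 : ℝ) ^ k * (V k p + -(3 * k)))
    (hD.prod isOpen_univ) (hDconn.isPreconnected.prod isPreconnected_univ) ?_ ?_ ?_ ?_ ?_
  · intro k p hp
    exact ((hVg k p hp.1).add (Good.const _ p)).smul (by positivity)
  · intro K hKD hK
    have h1 : ContinuousOn (fun p : ℂ × ℂ => rho D p.1) K := fun p hp =>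
      (good_rho hD (hKD hp).1).1.continuousWithinAt
    have h2 : ContinuousOn (fun p : ℂ × ℂ => Real.log (max ‖p.2‖ 1)) K := fun p hp =>
      (Good.log_max (G := fun x : ℂ × ℂ => x.2) analyticAt_snd one_pos).1.continuousWithinAt
    obtain ⟨R1, hR1⟩ := hK.bddAbove_image h1
    obtain ⟨R2, hR2⟩ := hK.bddAbove_image h2
    filter_upwards [hnat R1, hnat (3 + R2)] with k hk1 hk2 p hp
    have e1 : rho D p.1 ≤ R1 := hR1 (mem_image_of_mem _ hp)
    have e2 : Real.log (max ‖p.2‖ 1) ≤ R2 := hR2 (mem_image_of_mem _ hp)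
    have e3 := hVu k p (hKD hp).1 (e1.trans hk1)
    have hk0 : (0:ℝ) ≤ k := Nat.cast_nonneg k
    exact mul_nonpos_of_nonneg_of_nonpos (by positivity) (by linarith)
  · rintro ⟨z, w⟩ hp
    filter_upwards [hnat (rho D z + 1), hnat (Real.log (max ‖w‖ 1))] with k hk1 hk2
    have hk0 : (0:ℝ) ≤ k := Nat.cast_nonneg k
    apply hscale
    rcases hp with ⟨hz, hw⟩ | ⟨hz, -⟩
    · simp only at hz hw
      subst hw
      have := hVf k z hz (by linarith)
      linarith
    · have := hVA k (z, w) hz (by simp only; linarith)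
      simp only at this
      linarith
  · rintro ⟨z, w⟩ hp hpn
    have hzD : z ∈ D := hp.1
    have hzA : z ∉ A := fun h => hpn (Or.inr ⟨h, mem_univ _⟩)
    have hw : w ≠ f z := fun h => hpn (Or.inl ⟨⟨hzD, hzA⟩, h⟩)
    obtain ⟨d, hd, hd1, hdA⟩ : ∃ d : ℝ, 0 < d ∧ d ≤ 1 ∧ ∀ a ∈ A, d ≤ ‖z - a‖ := by
      have hzc : z ∈ (closure A)ᶜ := fun h => hzA (hAclosed z hzD h)
      obtain ⟨e, he, heA⟩ := Metric.isOpen_iff.1 isClosed_closure.isOpen_compl z hzc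
      refine ⟨min e 1, by positivity, min_le_right _ _, fun a ha => ?_⟩
      refine (min_le_left _ _).trans ?_
      by_contra! hcon
      refine heA (show a ∈ ball z e from ?_) (subset_closure ha)
      rw [mem_ball', dist_eq_norm]
      exact hcon
    set m : ℝ := Real.log d + min 0 (Real.log ‖w - f z‖) with hm
    have hsum : Summable fun k : ℕ => (1 / 2 : ℝ) ^ k * (|m| + 3 * k) := by
      have e1 : Summable fun k : ℕ => (1 / 2 : ℝ) ^ k := summable_geometric_two
      have e2 : Summable fun k : ℕ => (k : ℝ) ^ 1 * (1 / 2 : ℝ) ^ k :=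
        summable_pow_mul_geometric_of_norm_lt_one 1 (by norm_num)
      refine ((e1.mul_left |m|).add (e2.mul_left 3)).congr fun k => ?_
      ring
    refine Summable.of_norm_bounded_eventually_nat hsum ?_
    filter_upwards [hnat (rho D z), hnat (3 + Real.log (max ‖w‖ 1)), hpow (-Real.log d)]
      with k hk1 hk2 hk3
    have hk0 : (0:ℝ) ≤ k := Nat.cast_nonneg k
    have e1 := hVu k (z, w) hzD hk1
    have e2 := hVl k z ⟨hzD, hzA⟩ w hw d hd hd1 hdA (by linarith) (by linarith)
    simp only at e1
    rw [norm_mul, Real.norm_of_nonneg (by positivity)]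
    refine mul_le_mul_of_nonneg_left ?_ (by positivity)
    rw [Real.norm_eq_abs, abs_le]
    have := neg_abs_le m
    have := abs_nonneg m
    constructor <;> linarith
  · obtain ⟨z, hz, hzA⟩ := polar_not_open hApolar hD hDconn.nonempty
    refine ⟨(z, f z + 1), ⟨hz, mem_univ _⟩, ?_⟩
    rintro (⟨-, h⟩ | ⟨h, -⟩)
    · simp at h
    · exact hzA h
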